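/- arXiv:2105.14585 — 11 statements merged into one kernel-verified Lean document; each statement's English description precedes it below -/
import Mathlib

section
/- Let F be a field, let A₁ and A₂ be F-algebras, let M₁, M₁' be left A₁-modules and M₂, M₂' be left A₂-modules. Consider the canonical Hom-Tensor F-linear map Ψ : Hom_{A₁}(M₁, M₁') ⊗_F Hom_{A₂}(M₂, M₂') → Hom_{A₁ ⊗_F A₂}(M₁ ⊗_F M₂, M₁' ⊗_F M₂') determined by Ψ(f₁ ⊗ f₂)(m₁ ⊗ m₂) = f₁(m₁) ⊗ f₂(m₂). If M₁ and M₂ are finitely presented (over A₁ and A₂ respectively), then Ψ is a bijection (an isomorphism of F-vector spaces). -/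
open TensorProduct

variable (F : Type) [Field F]

section TensorModule

variable (A A' M M' : Type)
  [Ring A] [Algebra F A] [Ring A'] [Algebra F A']
  [AddCommGroup M] [Module F M] [Module A M] [IsScalarTower F A M]
  [AddCommGroup M'] [Module F M'] [Module A' M'] [IsScalarTower F A' M']

/-- The canonical action of `A ⊗[F] A'` on `M ⊗[F] M'`, determined by
`(a ⊗ a') • (m ⊗ m') = (a • m) ⊗ (a' • m')`. -/
noncomputable def tensorAction : A ⊗[F] A' →ₐ[F] Module.End F (M ⊗[F] M') :=
  (Module.endTensorEndAlgHom (R := F) (S := F) (A := F) (M := M) (N := M')).comp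
    (Algebra.TensorProduct.map
      (Algebra.lsmul F F M : A →ₐ[F] Module.End F M)
      (Algebra.lsmul F F M' : A' →ₐ[F] Module.End F M'))

/-- The natural `A ⊗[F] A'`-module structure on `M ⊗[F] M'`, given by
`(a ⊗ a') • (m ⊗ m') = (a • m) ⊗ (a' • m')`. -/
noncomputable instance tensorTensorModule : Module (A ⊗[F] A') (M ⊗[F] M') :=
  Module.compHom _ (tensorAction F A A' M M').toRingHom

theorem tensorTensorModule_smul_tmul (a : A) (a' : A') (m : M) (m' : M') :
    (a ⊗ₜ[F] a') • (m ⊗ₜ[F] m') = (a • m) ⊗ₜ[F] (a' • m') := rfl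

instance : SMulCommClass (A ⊗[F] A') F (M ⊗[F] M') :=
  ⟨fun x c v => ((tensorAction F A A' M M') x).map_smul c v⟩

instance : IsScalarTower F (A ⊗[F] A') (M ⊗[F] M') :=
  ⟨fun c x v => by
    show (tensorAction F A A' M M') (c • x) v = c • (tensorAction F A A' M M') x v
    rw [map_smul]; rfl⟩

end TensorModule

section HomTensor

variable {K A M M' V : Type} [Field K] [Ring A] [Algebra K A]
  [AddCommGroup M] [Module A M]
  [AddCommGroup M'] [Module K M'] [Module A M'] [IsScalarTower K A M']
  [AddCommGroup V] [Module K V]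

/-- An element of `Hom_A(M, M') ⊗ V` is determined by its evaluations at the elements of `M`. -/
theorem rTensor_apply_ext {t t' : (M →ₗ[A] M') ⊗[K] V}
    (h : ∀ m, (LinearMap.applyₗ' K m).rTensor V t = (LinearMap.applyₗ' K m).rTensor V t') :
    t = t' := by
  classical
  let b := Module.Basis.ofVectorSpace K V
  have key (s : (M →ₗ[A] M') ⊗[K] V) (m : M) (i) :
      equivFinsuppOfBasisRight b ((LinearMap.applyₗ' K m).rTensor V s) i =
        equivFinsuppOfBasisRight b s i m := by
    induction s with
    | zero => simp
    | add x y hx hy => simp [hx, hy]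
    | tmul f v => simp
  apply (equivFinsuppOfBasisRight b).injective
  ext i m
  rw [← key, ← key, h]

/-- An element of `V ⊗ Hom_A(M, M')` is determined by its evaluations at the elements of `M`. -/
theorem lTensor_apply_ext {t t' : V ⊗[K] (M →ₗ[A] M')}
    (h : ∀ m, (LinearMap.applyₗ' K m).lTensor V t = (LinearMap.applyₗ' K m).lTensor V t') :
    t = t' := by
  apply (TensorProduct.comm K _ _).injective
  refine rTensor_apply_ext fun m => ?_
  rw [LinearMap.rTensor_comm, LinearMap.rTensor_comm, h]

/-- If `M` is finitely generated, every `A`-linear map `M → M' ⊗ V` comes from an element of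
`Hom_A(M, M') ⊗ V`. -/
theorem exists_rTensor_apply_eq [Module.Finite A M] (f : M →ₗ[A] M' ⊗[K] V) :
    ∃ t : (M →ₗ[A] M') ⊗[K] V, ∀ m, (LinearMap.applyₗ' K m).rTensor V t = f m := by
  classical
  let b := Module.Basis.ofVectorSpace K V
  let c (i) : M →ₗ[A] M' := (AlgebraTensorModule.rid K A M').toLinearMap ∘ₗ
    AlgebraTensorModule.lTensor A M' (b.coord i) ∘ₗ f
  have hc (i m) : c i m = equivFinsuppOfBasisRight b (f m) i :=
    (equivFinsuppOfBasisRight_apply b (f m) i).symm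
  obtain ⟨G, hG⟩ := Module.Finite.fg_top (R := A) (M := M)
  let S := G.biUnion fun m => (equivFinsuppOfBasisRight b (f m)).support
  let g : M →ₗ[A] M' ⊗[K] V :=
    ∑ i ∈ S, (AlgebraTensorModule.mk K A M' V).flip (b i) ∘ₗ c i
  have hgf : g = f := by
    refine LinearMap.ext_on hG fun m hm => (equivFinsuppOfBasisRight b).symm_apply_apply (f m) ▸ ?_
    rw [equivFinsuppOfBasisRight_symm_apply, Finsupp.sum_of_support_subset (s := S)]
    · simp [g, hc]
    · exact Finset.subset_biUnion_of_mem
        (fun m => (equivFinsuppOfBasisRight b (f m)).support) hm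
    · simp
  refine ⟨∑ i ∈ S, c i ⊗ₜ b i, fun m => ?_⟩
  rw [← hgf]
  simp [g]

/-- If `M` is finitely generated, every `A`-linear map `M → V ⊗ M'`, with `A` acting on the right
factor, comes from an element of `V ⊗ Hom_A(M, M')`. -/
theorem exists_lTensor_apply_eq [Module.Finite A M] (f : M →+ V ⊗[K] M')
    (hf : ∀ (a : A) m, f (a • m) = (Algebra.lsmul K K M' a).lTensor V (f m)) :
    ∃ t : V ⊗[K] (M →ₗ[A] M'), ∀ m, (LinearMap.applyₗ' K m).lTensor V t = f m := by
  let g : M →ₗ[A] M' ⊗[K] V :=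
    { toFun m := TensorProduct.comm K V M' (f m)
      map_add' := by simp
      map_smul' a m := by
        rw [hf, ← LinearMap.rTensor_comm]
        rfl }
  obtain ⟨t, ht⟩ := exists_rTensor_apply_eq g
  refine ⟨(TensorProduct.comm K V _).symm t, fun m => (TensorProduct.comm K V M').injective ?_⟩
  rw [← LinearMap.rTensor_comm, LinearEquiv.apply_symm_apply, ht]
  rfl

end HomTensor

variable (A₁ A₂ M₁ M₂ M₁' M₂' : Type)
  [Ring A₁] [Algebra F A₁] [Ring A₂] [Algebra F A₂]
  [AddCommGroup M₁] [Module F M₁] [Module A₁ M₁] [IsScalarTower F A₁ M₁]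
  [AddCommGroup M₂] [Module F M₂] [Module A₂ M₂] [IsScalarTower F A₂ M₂]
  [AddCommGroup M₁'] [Module F M₁'] [Module A₁ M₁'] [IsScalarTower F A₁ M₁']
  [AddCommGroup M₂'] [Module F M₂'] [Module A₂ M₂'] [IsScalarTower F A₂ M₂']

/-- If `M₁` and `M₂` are finitely presented, then the canonical Hom-Tensor map
`Ψ : Hom_{A₁}(M₁, M₁') ⊗[F] Hom_{A₂}(M₂, M₂') → Hom_{A₁ ⊗[F] A₂}(M₁ ⊗[F] M₂, M₁' ⊗[F] M₂')`,
determined by `Ψ(f₁ ⊗ f₂)(m₁ ⊗ m₂) = f₁(m₁) ⊗ f₂(m₂)`, is a bijection. -/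
theorem stmt1 [Module.FinitePresentation A₁ M₁] [Module.FinitePresentation A₂ M₂] :
    ∀ Ψ : ((M₁ →ₗ[A₁] M₁') ⊗[F] (M₂ →ₗ[A₂] M₂')) →ₗ[F]
        ((M₁ ⊗[F] M₂) →ₗ[A₁ ⊗[F] A₂] (M₁' ⊗[F] M₂')),
      (∀ (f₁ : M₁ →ₗ[A₁] M₁') (f₂ : M₂ →ₗ[A₂] M₂') (m₁ : M₁) (m₂ : M₂),
        Ψ (f₁ ⊗ₜ[F] f₂) (m₁ ⊗ₜ[F] m₂) = f₁ m₁ ⊗ₜ[F] f₂ m₂) →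
      Function.Bijective Ψ := by
  intro Ψ hΨ
  have hΨ' (t m₁ m₂) : Ψ t (m₁ ⊗ₜ m₂) = (LinearMap.applyₗ' F m₂).lTensor M₁'
      ((LinearMap.applyₗ' F m₁).rTensor (M₂ →ₗ[A₂] M₂') t) := by
    induction t with
    | zero => simp
    | add x y hx hy => simp [hx, hy]
    | tmul f g => simp [hΨ]
  refine ⟨fun t t' h => rTensor_apply_ext fun m₁ => lTensor_apply_ext fun m₂ => ?_, fun h => ?_⟩
  · rw [← hΨ', ← hΨ', h]
  have hsmul (a₁ : A₁) (a₂ : A₂) (m₁ : M₁) (m₂ : M₂) :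
      h ((a₁ • m₁) ⊗ₜ (a₂ • m₂)) = (a₁ ⊗ₜ[F] a₂) • h (m₁ ⊗ₜ m₂) := h.map_smul (a₁ ⊗ₜ a₂) (m₁ ⊗ₜ m₂)
  have smul_left (a₁ : A₁) (x : M₁' ⊗[F] M₂') : (a₁ ⊗ₜ[F] (1 : A₂)) • x = a₁ • x := by
    induction x with
    | zero => simp
    | add x y hx hy => simp [hx, hy]
    | tmul x y => simp [tensorTensorModule_smul_tmul, smul_tmul']
  have smul_right (a₂ : A₂) (x : M₁' ⊗[F] M₂') :
      ((1 : A₁) ⊗ₜ[F] a₂) • x = (Algebra.lsmul F F M₂' a₂).lTensor M₁' x := by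
    induction x with
    | zero => simp
    | add x y hx hy => simp [hx, hy]
    | tmul x y => simp [tensorTensorModule_smul_tmul]
  have partial_hom (m₂ : M₂) : ∃ t : (M₁ →ₗ[A₁] M₁') ⊗[F] M₂',
      ∀ m₁, (LinearMap.applyₗ' F m₁).rTensor M₂' t = h (m₁ ⊗ₜ m₂) :=
    exists_rTensor_apply_eq
      { toFun m₁ := h (m₁ ⊗ₜ m₂)
        map_add' x y := by rw [add_tmul, map_add]
        map_smul' a x := by simpa [smul_left] using hsmul a 1 x m₂ }
  choose T hT using partial_hom
  let T' : M₂ →+ (M₁ →ₗ[A₁] M₁') ⊗[F] M₂' := AddMonoidHom.mk' T fun x y =>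
    rTensor_apply_ext fun m₁ => by rw [map_add, hT, hT, hT, tmul_add, map_add]
  obtain ⟨t, ht⟩ := exists_lTensor_apply_eq T' fun a m₂ => rTensor_apply_ext fun m₁ => by
    have := hsmul 1 a m₁ m₂
    rw [one_smul, smul_right] at this
    rw [← LinearMap.comp_apply, LinearMap.rTensor_comp_lTensor, ← LinearMap.lTensor_comp_rTensor,
      LinearMap.comp_apply]
    exact (hT _ _).trans (this.trans (by rw [← hT]; rfl))
  refine ⟨t, LinearMap.ext fun x => ?_⟩
  induction x with
  | zero => simp
  | add x y hx hy => rw [map_add, map_add, hx, hy]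
  | tmul m₁ m₂ =>
    rw [hΨ', ← hT m₂ m₁, show T m₂ = _ from (ht m₂).symm, ← LinearMap.comp_apply,
      LinearMap.lTensor_comp_rTensor, ← LinearMap.rTensor_comp_lTensor, LinearMap.comp_apply]
end

section
/- Let F be a field and let M₁ and M₂ be finitely presented left modules over F-algebras A₁ and A₂ respectively. Then the canonical map End_{A₁}(M₁) ⊗_F End_{A₂}(M₂) → End_{A₁ ⊗_F A₂}(M₁ ⊗_F M₂), sending f₁ ⊗ f₂ to the endomorphism m₁ ⊗ m₂ ↦ f₁(m₁) ⊗ f₂(m₂), is an isomorphism of F-algebras. -/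
open TensorProduct

variable (F : Type) [Field F]

section HomTensor

variable (A M N V : Type) [Ring A] [Algebra F A]
  [AddCommGroup M] [Module A M]
  [AddCommGroup N] [Module F N] [Module A N] [IsScalarTower F A N]
  [AddCommGroup V] [Module F V]

/-- The canonical map `Hom_A(M, N) ⊗[F] V → Hom_A(M, N ⊗[F] V)`. -/
noncomputable def homTensorVec : (M →ₗ[A] N) ⊗[F] V →ₗ[F] (M →ₗ[A] N ⊗[F] V) :=
  TensorProduct.lift <| LinearMap.mk₂ F
    (fun f v => ((AlgebraTensorModule.mk F A N V).flip v).comp f)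
    (fun _ _ _ => by ext; simp [add_tmul])
    (fun _ _ _ => by ext; simp [smul_tmul'])
    (fun _ _ _ => by ext; simp)
    (fun _ _ _ => by ext; simp)

@[simp]
theorem homTensorVec_tmul_apply (f : M →ₗ[A] N) (v : V) (m : M) :
    homTensorVec F A M N V (f ⊗ₜ v) m = f m ⊗ₜ v := rfl

variable {V} in
/-- A basis of `V` over `F` identifies `N ⊗[F] V` with a direct sum of copies of `N`. -/
noncomputable def tensorVecEquivFinsupp {κ : Type} [DecidableEq κ] (c : Module.Basis κ F V) :
    N ⊗[F] V ≃ₗ[A] κ →₀ N :=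
  AlgebraTensorModule.congr (.refl A N) c.repr ≪≫ₗ finsuppScalarRight F A N κ

variable {V} in
theorem tensorVecEquivFinsupp_tmul_apply {κ : Type} [DecidableEq κ] (c : Module.Basis κ F V)
    (n : N) (v : V) (k : κ) : tensorVecEquivFinsupp F A N c (n ⊗ₜ v) k = c.repr v k • n := by
  simp [tensorVecEquivFinsupp]

theorem homTensorVec_injective : Function.Injective (homTensorVec F A M N V) := by
  classical
  let c := Module.Basis.ofVectorSpace F V
  have key (x : (M →ₗ[A] N) ⊗[F] V) (k) (m : M) :
      tensorVecEquivFinsupp F A N c (homTensorVec F A M N V x m) k =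
        equivFinsuppOfBasisRight c x k m := by
    induction x with
    | zero => simp
    | tmul f v => simp [tensorVecEquivFinsupp_tmul_apply]
    | add x y hx hy => simp [hx, hy]
  rw [injective_iff_map_eq_zero]
  intro x hx
  apply (equivFinsuppOfBasisRight c).injective
  ext k m
  simp [← key, hx]

theorem homTensorVec_surjective [Module.Finite A M] :
    Function.Surjective (homTensorVec F A M N V) := by
  classical
  intro f
  let c := Module.Basis.ofVectorSpace F V
  let e := tensorVecEquivFinsupp F A N c
  obtain ⟨s, hs⟩ := Module.Finite.fg_top (R := A) (M := M)
  let t := s.biUnion fun m => (e (f m)).support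
  have ht (m : M) : e (f m) ∈ Finsupp.supported N A (t : Set _) := by
    have : (⊤ : Submodule A M) ≤
        (Finsupp.supported N A (t : Set _)).comap (e.toLinearMap ∘ₗ f) := by
      rw [← hs, Submodule.span_le]
      intro m hm
      exact (Finsupp.mem_supported A _).mpr <| Finset.coe_subset.mpr <|
        Finset.subset_biUnion_of_mem (fun m => (e (f m)).support) hm
    exact this trivial
  refine ⟨∑ k ∈ t, (Finsupp.lapply k ∘ₗ e.toLinearMap ∘ₗ f) ⊗ₜ c k, ?_⟩
  ext m
  apply e.injective
  ext k
  simp only [map_sum, LinearMap.sum_apply, homTensorVec_tmul_apply, Finsupp.finsetSum_apply]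
  simp only [e, tensorVecEquivFinsupp_tmul_apply]
  by_cases hk : k ∈ t
  · simp [Finsupp.single_apply, hk]
  · have := Finsupp.notMem_support_iff.mp fun h => hk ((Finsupp.mem_supported A _).mp (ht m) h)
    simpa [Finsupp.single_apply, hk] using this.symm

/-- If `M` is finitely generated over `A`, then `Hom_A(M, N) ⊗[F] V ≃ Hom_A(M, N ⊗[F] V)`. -/
noncomputable def homTensorVecEquiv [Module.Finite A M] :
    (M →ₗ[A] N) ⊗[F] V ≃ₗ[F] (M →ₗ[A] N ⊗[F] V) :=
  .ofBijective (homTensorVec F A M N V)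
    ⟨homTensorVec_injective F A M N V, homTensorVec_surjective F A M N V⟩

@[simp]
theorem homTensorVecEquiv_tmul_apply [Module.Finite A M] (f : M →ₗ[A] N) (v : V) (m : M) :
    homTensorVecEquiv F A M N V (f ⊗ₜ v) m = f m ⊗ₜ v := rfl

end HomTensor

variable (A₁ A₂ M₁ M₂ : Type)
  [Ring A₁] [Algebra F A₁] [Ring A₂] [Algebra F A₂]
  [AddCommGroup M₁] [Module F M₁] [Module A₁ M₁] [IsScalarTower F A₁ M₁]
  [AddCommGroup M₂] [Module F M₂] [Module A₂ M₂] [IsScalarTower F A₂ M₂]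

/-- The endomorphism `f₁ ⊗ f₂` of the `A₁ ⊗[F] A₂`-module `M₁ ⊗[F] M₂`. -/
noncomputable def endTensorMap (f₁ : Module.End A₁ M₁) (f₂ : Module.End A₂ M₂) :
    Module.End (A₁ ⊗[F] A₂) (M₁ ⊗[F] M₂) where
  __ := TensorProduct.map (f₁.restrictScalars F) (f₂.restrictScalars F)
  map_smul' r x := by
    simp only [AddHom.toFun_eq_coe, LinearMap.coe_toAddHom, RingHom.id_apply]
    induction r with
    | zero => simp
    | add r s hr hs => simp only [add_smul, map_add, hr, hs]
    | tmul a b =>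
      induction x with
      | zero => simp
      | add x y hx hy => simp only [smul_add, map_add, hx, hy]
      | tmul m n => simp [tensorTensorModule_smul_tmul]

@[simp]
theorem endTensorMap_tmul (f₁ : Module.End A₁ M₁) (f₂ : Module.End A₂ M₂) (m₁ : M₁) (m₂ : M₂) :
    endTensorMap F A₁ A₂ M₁ M₂ f₁ f₂ (m₁ ⊗ₜ m₂) = f₁ m₁ ⊗ₜ f₂ m₂ := rfl

variable {F A₁ A₂ M₁ M₂} in
theorem end_tensor_ext {f g : Module.End (A₁ ⊗[F] A₂) (M₁ ⊗[F] M₂)}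
    (h : ∀ m₁ m₂, f (m₁ ⊗ₜ m₂) = g (m₁ ⊗ₜ m₂)) : f = g := by
  ext x
  induction x with
  | zero => simp
  | tmul m₁ m₂ => exact h m₁ m₂
  | add x y hx hy => simp [hx, hy]

/-- The canonical algebra homomorphism
`End_{A₁}(M₁) ⊗[F] End_{A₂}(M₂) → End_{A₁ ⊗[F] A₂}(M₁ ⊗[F] M₂)`. -/
noncomputable def endTensorAlgHom :
    Module.End A₁ M₁ ⊗[F] Module.End A₂ M₂ →ₐ[F] Module.End (A₁ ⊗[F] A₂) (M₁ ⊗[F] M₂) :=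
  Algebra.TensorProduct.algHomOfLinearMapTensorProduct
    (TensorProduct.lift <| LinearMap.mk₂ F (endTensorMap F A₁ A₂ M₁ M₂)
      (fun _ _ _ => end_tensor_ext fun _ _ => by simp [add_tmul])
      (fun _ _ _ => end_tensor_ext fun _ _ => by simp [smul_tmul'])
      (fun _ _ _ => end_tensor_ext fun _ _ => by simp [tmul_add])
      (fun _ _ _ => end_tensor_ext fun _ _ => by simp [tmul_smul]))
    (fun _ _ _ _ => end_tensor_ext fun _ _ => by simp)
    (end_tensor_ext fun _ _ => by simp)

@[simp]
theorem endTensorAlgHom_tmul_tmul (f₁ : Module.End A₁ M₁) (f₂ : Module.End A₂ M₂)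
    (m₁ : M₁) (m₂ : M₂) :
    endTensorAlgHom F A₁ A₂ M₁ M₂ (f₁ ⊗ₜ f₂) (m₁ ⊗ₜ m₂) = f₁ m₁ ⊗ₜ f₂ m₂ := rfl

/-- If `M₂` is finitely generated over `A₂`, then
`M₁ ⊗[F] End_{A₂}(M₂) ≃ Hom_{A₂}(M₂, M₂ ⊗[F] M₁)`. -/
noncomputable def tensorEndEquiv [Module.Finite A₂ M₂] :
    M₁ ⊗[F] Module.End A₂ M₂ ≃ₗ[F] (M₂ →ₗ[A₂] M₂ ⊗[F] M₁) :=
  TensorProduct.comm F M₁ (Module.End A₂ M₂) ≪≫ₗ homTensorVecEquiv F A₂ M₂ M₂ M₁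

@[simp]
theorem tensorEndEquiv_tmul_apply [Module.Finite A₂ M₂] (m₁ : M₁) (f : Module.End A₂ M₂)
    (m₂ : M₂) : tensorEndEquiv F A₂ M₁ M₂ (m₁ ⊗ₜ f) m₂ = f m₂ ⊗ₜ m₁ := rfl

theorem tensorEndEquiv_smul_apply [Module.Finite A₂ M₂] (a : A₁)
    (y : M₁ ⊗[F] Module.End A₂ M₂) (m₂ : M₂) :
    TensorProduct.comm F M₂ M₁ (tensorEndEquiv F A₂ M₁ M₂ (a • y) m₂) =
      a • TensorProduct.comm F M₂ M₁ (tensorEndEquiv F A₂ M₁ M₂ y m₂) := by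
  induction y with
  | zero => simp
  | tmul m f => simp [smul_tmul']
  | add x y hx hy => simp only [smul_add, map_add, LinearMap.add_apply, hx, hy]

theorem endTensorAlgHom_apply_tmul [Module.Finite A₁ M₁] [Module.Finite A₂ M₂]
    (x : Module.End A₁ M₁ ⊗[F] Module.End A₂ M₂) (m₁ : M₁) (m₂ : M₂) :
    endTensorAlgHom F A₁ A₂ M₁ M₂ x (m₁ ⊗ₜ m₂) =
      TensorProduct.comm F M₂ M₁ (tensorEndEquiv F A₂ M₁ M₂
        (homTensorVecEquiv F A₁ M₁ M₁ (Module.End A₂ M₂) x m₁) m₂) := by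
  induction x with
  | zero => simp
  | tmul f g => simp
  | add x y hx hy => simp only [map_add, LinearMap.add_apply, hx, hy]

theorem endTensorAlgHom_injective [Module.Finite A₁ M₁] [Module.Finite A₂ M₂] :
    Function.Injective (endTensorAlgHom F A₁ A₂ M₁ M₂) := by
  intro x y hxy
  apply (homTensorVecEquiv F A₁ M₁ M₁ (Module.End A₂ M₂)).injective
  ext m₁
  apply (tensorEndEquiv F A₂ M₁ M₂).injective
  ext m₂
  apply (TensorProduct.comm F M₂ M₁).injective
  rw [← endTensorAlgHom_apply_tmul, ← endTensorAlgHom_apply_tmul, hxy]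

variable {F A₁ A₂ M₁ M₂} in
/-- An endomorphism `g` of `M₁ ⊗[F] M₂` and `m₁ : M₁` give the `A₂`-linear map
`m₂ ↦ g (m₁ ⊗ m₂)`, with the tensor factors of the target swapped. -/
noncomputable def endTensorCurry (g : Module.End (A₁ ⊗[F] A₂) (M₁ ⊗[F] M₂)) (m₁ : M₁) :
    M₂ →ₗ[A₂] M₂ ⊗[F] M₁ where
  toFun m₂ := TensorProduct.comm F M₁ M₂ (g (m₁ ⊗ₜ m₂))
  map_add' _ _ := by simp [tmul_add]
  map_smul' a m₂ := by
    have comm_smul (y : M₁ ⊗[F] M₂) : TensorProduct.comm F M₁ M₂ ((1 : A₁) ⊗ₜ[F] a • y) =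
        a • TensorProduct.comm F M₁ M₂ y := by
      induction y with
      | zero => simp
      | tmul m n => simp [tensorTensorModule_smul_tmul, smul_tmul']
      | add x y hx hy => simp only [smul_add, map_add, hx, hy]
    rw [RingHom.id_apply, ← comm_smul, ← map_smul, tensorTensorModule_smul_tmul, one_smul]

theorem endTensorAlgHom_surjective [Module.Finite A₁ M₁] [Module.Finite A₂ M₂] :
    Function.Surjective (endTensorAlgHom F A₁ A₂ M₁ M₂) := by
  intro g
  let ψ := tensorEndEquiv F A₂ M₁ M₂
  have smul_left (a : A₁) (y : M₁ ⊗[F] M₂) : (a ⊗ₜ[F] (1 : A₂)) • y = a • y := by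
    induction y with
    | zero => simp
    | tmul m n => simp [tensorTensorModule_smul_tmul, smul_tmul']
    | add x y hx hy => simp only [smul_add, hx, hy]
  let G : M₁ →ₗ[A₁] M₁ ⊗[F] Module.End A₂ M₂ :=
    { toFun m₁ := ψ.symm (endTensorCurry g m₁)
      map_add' m n := by
        rw [← map_add]
        congr 1
        ext m₂
        simp [endTensorCurry, add_tmul]
      map_smul' a m := by
        rw [LinearEquiv.symm_apply_eq]
        ext m₂
        apply (TensorProduct.comm F M₂ M₁).injective
        rw [RingHom.id_apply, tensorEndEquiv_smul_apply, LinearEquiv.apply_symm_apply]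
        simp only [endTensorCurry, LinearMap.coe_mk, AddHom.coe_mk, TensorProduct.comm_comm]
        rw [← smul_left, ← map_smul, tensorTensorModule_smul_tmul, one_smul] }
  refine ⟨(homTensorVecEquiv F A₁ M₁ M₁ (Module.End A₂ M₂)).symm G, end_tensor_ext fun m₁ m₂ => ?_⟩
  rw [endTensorAlgHom_apply_tmul, LinearEquiv.apply_symm_apply]
  simp [G, ψ, endTensorCurry]

/-- If `M₁` and `M₂` are finitely presented left modules over the `F`-algebras `A₁` and `A₂`
respectively, then the canonical map
`End_{A₁}(M₁) ⊗[F] End_{A₂}(M₂) → End_{A₁ ⊗[F] A₂}(M₁ ⊗[F] M₂)`,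
sending `f₁ ⊗ f₂` to `m₁ ⊗ m₂ ↦ f₁(m₁) ⊗ f₂(m₂)`, is an isomorphism of `F`-algebras. -/
theorem stmt2 [Module.FinitePresentation A₁ M₁] [Module.FinitePresentation A₂ M₂] :
    ∃ e : (Module.End A₁ M₁ ⊗[F] Module.End A₂ M₂) ≃ₐ[F]
        Module.End (A₁ ⊗[F] A₂) (M₁ ⊗[F] M₂),
      ∀ (f₁ : Module.End A₁ M₁) (f₂ : Module.End A₂ M₂) (m₁ : M₁) (m₂ : M₂),
        e (f₁ ⊗ₜ[F] f₂) (m₁ ⊗ₜ[F] m₂) = f₁ m₁ ⊗ₜ[F] f₂ m₂ := by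
  exact ⟨.ofBijective (endTensorAlgHom F A₁ A₂ M₁ M₂)
    ⟨endTensorAlgHom_injective F A₁ A₂ M₁ M₂, endTensorAlgHom_surjective F A₁ A₂ M₁ M₂⟩,
    endTensorAlgHom_tmul_tmul F A₁ A₂ M₁ M₂⟩
end

section
/- Let D be a division algebra over a field F (so F acts centrally via the algebra structure), and let d ∈ D be transcendental over F, i.e. d is not a root of any nonzero polynomial with coefficients in F. Then the family ((d − λ·1)⁻¹)_{λ ∈ F} of elements of D is linearly independent over F. -/
open Polynomial in
theorem linearIndependent_sub_inv_of_transcendental {F D : Type*} [Field F]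
    [DivisionRing D] [Algebra F D] {d : D} (hd : Transcendental F d) :
    LinearIndependent F fun a : F ↦ (d - algebraMap F D a)⁻¹ := by
  classical
  rw [transcendental_iff] at hd
  refine linearIndependent_iff'.2 fun s m hm i hi ↦ ?_
  have hnz (a : F) : d - algebraMap F D a ≠ 0 := by
    intro h
    refine X_sub_C_ne_zero a (hd (X - C a) ?_)
    rw [map_sub, aeval_X, aeval_C, h]
  obtain ⟨q, hq_def⟩ : ∃ q : Finset F → F[X], ∀ t, q t = t.prod fun j ↦ X - C j :=
    ⟨_, fun _ ↦ rfl⟩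
  have hq : ∀ j ∈ s, aeval d (q s) * (d - algebraMap F D j)⁻¹ = aeval d (q (s.erase j)) := by
    intro j hj
    have hs : q s = q (s.erase j) * (X - C j) := by
      rw [hq_def, hq_def, s.prod_erase_mul _ hj]
    rw [hs, map_mul, map_sub, aeval_X, aeval_C, mul_inv_cancel_right₀ (hnz j)]
  have hp : aeval d (s.sum fun j ↦ C (m j) * q (s.erase j)) = 0 := by
    rw [← mul_zero (aeval d (q s)), ← hm, Finset.mul_sum, map_sum]
    refine Finset.sum_congr rfl fun j hj ↦ ?_
    rw [mul_smul_comm, hq j hj, map_mul, aeval_C, Algebra.smul_def]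
  have heval : (s.sum fun j ↦ C (m j) * q (s.erase j)).eval i =
      m i * (q (s.erase i)).eval i := by
    rw [eval_finsetSum, Finset.sum_eq_single_of_mem i hi, eval_mul, eval_C]
    intro j _ hji
    rw [eval_mul, hq_def, eval_prod,
      Finset.prod_eq_zero (Finset.mem_erase.2 ⟨hji.symm, hi⟩) (by simp), mul_zero]
  rw [hd _ hp, eval_zero, hq_def, eval_prod] at heval
  refine (mul_eq_zero.1 heval.symm).resolve_right (Finset.prod_ne_zero_iff.2 fun j hj ↦ ?_)
  simpa [sub_eq_zero] using (Finset.ne_of_mem_erase hj).symm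

/-- If `D` is a division algebra over a field `F` and `d ∈ D` is transcendental over `F`,
then the family `((d - λ·1)⁻¹)_{λ ∈ F}` is linearly independent over `F`. -/
theorem stmt3 (F D : Type) [Field F] [DivisionRing D] [Algebra F D]
    (d : D) (hd : Transcendental F d) :
    LinearIndependent F fun lam : F => (d - algebraMap F D lam)⁻¹ :=
  linearIndependent_sub_inv_of_transcendental hd
end

section
/- Let F be an algebraically closed field, let A be an F-algebra, and let M be a simple left A-module whose dimension over F is strictly smaller than the cardinality of F. Then every A-module endomorphism of M is multiplication by a scalar from F; that is, End_A(M) = F·Id_M (equivalently, M is absolutely simple over F). -/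
open Polynomial in
/-- If every nonzero polynomial in `f` is injective at `w`, then vectors `v a` with
`(f - a) (v a) = w` are linearly independent. -/
theorem Module.End.linearIndependent_of_sub_smul_eq {F V : Type*} [Field F] [AddCommGroup V]
    [Module F V] (f : Module.End F V) {w : V} (hw : ∀ p : F[X], aeval f p w = 0 → p = 0)
    (v : F → V) (hv : ∀ a, aeval f (X - C a) (v a) = w) : LinearIndependent F v := by
  classical
  refine linearIndependent_iff'.2 fun s m hm i hi ↦ ?_
  let p : F[X] := ∑ j ∈ s, C (m j) * ∏ k ∈ s.erase j, (X - C k)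
  have hp : p = 0 := by
    apply hw
    have h := congrArg (aeval f (∏ k ∈ s, (X - C k))) hm
    rw [map_zero, map_sum] at h
    rw [← h, map_sum, LinearMap.sum_apply]
    refine Finset.sum_congr rfl fun j hj ↦ ?_
    rw [← s.prod_erase_mul _ hj, map_smul, map_mul, map_mul, Module.End.mul_apply,
      Module.End.mul_apply, hv, aeval_C, Module.algebraMap_end_apply]
  have he := congrArg (eval i) hp
  simp only [p, eval_finsetSum, eval_mul, eval_C, eval_prod, eval_sub, eval_X, eval_zero] at he
  rw [Finset.sum_eq_single_of_mem i hi fun j _ hji ↦ by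
    rw [Finset.prod_eq_zero (Finset.mem_erase.2 ⟨hji.symm, hi⟩) (sub_self i), mul_zero]] at he
  exact (mul_eq_zero.1 he).resolve_right <| Finset.prod_ne_zero_iff.2 fun j hj ↦
    sub_ne_zero.2 (Finset.ne_of_mem_erase hj).symm

universe u v

open Polynomial in
/-- An endomorphism of a nontrivial vector space whose dimension is less than the cardinality
of its algebraically closed ground field has nonempty spectrum. -/
theorem Module.End.spectrum_nonempty_of_rank_lt {F : Type u} {V : Type v} [Field F] [IsAlgClosed F]
    [AddCommGroup V] [Module F V] [Nontrivial V]
    (h : Cardinal.lift.{u} (Module.rank F V) < Cardinal.lift.{v} (Cardinal.mk F)) (f : Module.End F V) :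
    (spectrum F f).Nonempty := by
  by_contra hf
  have hunit (p : F[X]) (hp : p ≠ 0) : IsUnit (aeval f p) := by
    rw [(IsAlgClosed.splits p).eq_prod_roots, map_mul, aeval_C]
    refine ((Units.mk0 _ (leadingCoeff_ne_zero.2 hp)).isUnit.map (algebraMap F _)).mul ?_
    by_contra hprod
    obtain ⟨k, hk, -⟩ := spectrum.exists_mem_of_not_isUnit_aeval_prod hprod
    exact hf ⟨k, hk⟩
  obtain ⟨w, hw⟩ := exists_ne (0 : V)
  choose v hv using fun a : F ↦
    ((Module.End.isUnit_iff _).1 (hunit (X - C a) (X_sub_C_ne_zero a))).2 w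
  have hli := f.linearIndependent_of_sub_smul_eq (fun p hp ↦ by
    by_contra hp0
    exact hw (((Module.End.isUnit_iff _).1 (hunit p hp0)).1 (hp.trans (map_zero _).symm))) v hv
  exact h.not_ge hli.cardinal_lift_le_rank

/-- Let `F` be an algebraically closed field, `A` an `F`-algebra and `M` a simple left
`A`-module with `dim_F M < |F|`. Then every `A`-module endomorphism of `M` is multiplication
by a scalar from `F`; i.e. `M` is absolutely simple over `F`. -/
theorem stmt4 (F A M : Type) [Field F] [IsAlgClosed F] [Ring A] [Algebra F A]
    [AddCommGroup M] [Module F M] [Module A M] [IsScalarTower F A M]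
    [IsSimpleModule A M] (hdim : Module.rank F M < Cardinal.mk F) :
    ∀ φ : M →ₗ[A] M, ∃ c : F, ∀ m : M, φ m = c • m := by
  intro φ
  have := IsSimpleModule.nontrivial A M
  have := IsScalarTower.to_smulCommClass' (R := F) (A := A) (M := M)
  obtain ⟨c, hc⟩ := Module.End.spectrum_nonempty_of_rank_lt
    (Cardinal.lift_lt.2 hdim) (φ.restrictScalars F)
  refine ⟨c, fun m ↦ ?_⟩
  let ψ : M →ₗ[A] M := c • LinearMap.id - φ
  rcases ψ.bijective_or_eq_zero with h | h
  · exact absurd ((Module.End.isUnit_iff (algebraMap F (Module.End F M) c - φ.restrictScalars F)).2 h)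
      hc
  · exact (sub_eq_zero.1 (LinearMap.congr_fun h m)).symm
end

section
/- Let F be a field, let A and A' be F-algebras, let M be an absolutely simple left A-module (i.e. M is simple and End_A(M) = F·Id_M), and let M' be any left A'-module. Then the map End_{A'}(M') → End_{A ⊗_F A'}(M ⊗_F M') sending f to the endomorphism m ⊗ m' ↦ m ⊗ f(m') is an isomorphism of F-algebras; in particular End_{A ⊗_F A'}(M ⊗_F M') ≅ End_A(M) ⊗_F End_{A'}(M') ≅ End_{A'}(M'). -/
open TensorProduct

variable (F : Type) [Field F]

variable (A A' M M' : Type)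
  [Ring A] [Algebra F A] [Ring A'] [Algebra F A']
  [AddCommGroup M] [Module F M] [Module A M] [IsScalarTower F A M]
  [AddCommGroup M'] [Module F M'] [Module A' M'] [IsScalarTower F A' M']

/-- Over a field, elements of `M ⊗[F] N` are separated by the maps `id ⊗ l`, where `l` ranges over
the linear functionals on `N`. -/
theorem TensorProduct.ext_of_lTensor_dual {K V W : Type*} [Field K] [AddCommGroup V] [Module K V]
    [AddCommGroup W] [Module K W] {x y : V ⊗[K] W}
    (h : ∀ l : Module.Dual K W,
      TensorProduct.rid K V (l.lTensor V x) = TensorProduct.rid K V (l.lTensor V y)) : x = y := by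
  classical
  apply (TensorProduct.equivFinsuppOfBasisRight (M := V)
    (Module.Basis.ofVectorSpace K W)).injective
  ext i
  rw [TensorProduct.equivFinsuppOfBasisRight_apply,
    TensorProduct.equivFinsuppOfBasisRight_apply, h]

/-- Contracting the second factor of `M ⊗[F] M'` commutes with the action of `A`. -/
theorem rid_lTensor_tmul_one_smul (l : Module.Dual F M') (a : A) (z : M ⊗[F] M') :
    TensorProduct.rid F M (l.lTensor M ((a ⊗ₜ[F] (1 : A')) • z)) =
      a • TensorProduct.rid F M (l.lTensor M z) := by
  induction z with
  | zero => simp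
  | tmul m m' =>
    rw [tensorTensorModule_smul_tmul, one_smul, LinearMap.lTensor_tmul, LinearMap.lTensor_tmul,
      TensorProduct.rid_tmul, TensorProduct.rid_tmul, smul_comm]
  | add x y hx hy => simp only [smul_add, map_add, hx, hy]

/-- Contracting the first factor of `M ⊗[F] M'` commutes with the action of `A'`. -/
theorem lid_rTensor_one_tmul_smul (l : Module.Dual F M) (a : A') (z : M ⊗[F] M') :
    TensorProduct.lid F M' (l.rTensor M' (((1 : A) ⊗ₜ[F] a) • z)) =
      a • TensorProduct.lid F M' (l.rTensor M' z) := by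
  induction z with
  | zero => simp
  | tmul m m' =>
    rw [tensorTensorModule_smul_tmul, one_smul, LinearMap.rTensor_tmul, LinearMap.rTensor_tmul,
      TensorProduct.lid_tmul, TensorProduct.lid_tmul, smul_comm]
  | add x y hx hy => simp only [smul_add, map_add, hx, hy]

/-- The `A`-endomorphism of `M` obtained from `g` by fixing the second tensor factor of the
argument and contracting the second factor of the value. -/
noncomputable def endOfContractRight (g : Module.End (A ⊗[F] A') (M ⊗[F] M')) (m' : M')
    (l : Module.Dual F M') : M →ₗ[A] M where
  toFun m := TensorProduct.rid F M (l.lTensor M (g (m ⊗ₜ m')))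
  map_add' x y := by simp [TensorProduct.add_tmul]
  map_smul' a x := by
    have : (a • x) ⊗ₜ[F] m' = (a ⊗ₜ[F] (1 : A')) • (x ⊗ₜ[F] m') := by
      rw [tensorTensorModule_smul_tmul, one_smul]
    rw [this, map_smul, rid_lTensor_tmul_one_smul, RingHom.id_apply]

/-- The `A'`-endomorphism of `M'` obtained from `g` by fixing the first tensor factor of the
argument and contracting the first factor of the value. -/
noncomputable def endOfContractLeft (g : Module.End (A ⊗[F] A') (M ⊗[F] M')) (m : M)
    (l : Module.Dual F M) : M' →ₗ[A'] M' where
  toFun m' := TensorProduct.lid F M' (l.rTensor M' (g (m ⊗ₜ m')))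
  map_add' x y := by simp [TensorProduct.tmul_add]
  map_smul' a x := by
    have : m ⊗ₜ[F] (a • x) = ((1 : A) ⊗ₜ[F] a) • (m ⊗ₜ[F] x) := by
      rw [tensorTensorModule_smul_tmul, one_smul]
    rw [this, map_smul, lid_rTensor_one_tmul_smul, RingHom.id_apply]

theorem apply_tmul_eq_tmul_endOfContractLeft
    (habs : ∀ φ : M →ₗ[A] M, ∃ c : F, ∀ m : M, φ m = c • m)
    (g : Module.End (A ⊗[F] A') (M ⊗[F] M')) {m₀ : M} {l₀ : Module.Dual F M} (hl₀ : l₀ m₀ = 1)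
    (m : M) (m' : M') :
    g (m ⊗ₜ m') = m ⊗ₜ endOfContractLeft F A A' M M' g m₀ l₀ m' := by
  refine TensorProduct.ext_of_lTensor_dual fun l => ?_
  obtain ⟨c, hc⟩ := habs (endOfContractRight F A A' M M' g m' l)
  have swap (z : M ⊗[F] M') : l (TensorProduct.lid F M' (l₀.rTensor M' z)) =
      l₀ (TensorProduct.rid F M (l.lTensor M z)) := by
    induction z with
    | zero => simp
    | tmul x y => simp [mul_comm]
    | add x y hx hy => simp [hx, hy]
  have hcl : l (endOfContractLeft F A A' M M' g m₀ l₀ m') = c :=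
    calc
      _ = l₀ (endOfContractRight F A A' M M' g m' l m₀) := swap _
      _ = c := by rw [hc, map_smul, hl₀, smul_eq_mul, mul_one]
  rw [LinearMap.lTensor_tmul, TensorProduct.rid_tmul, hcl]
  exact hc m

/-- If `M` is an absolutely simple left `A`-module and `M'` is any left `A'`-module, then the
canonical map `End_{A'}(M') → End_{A ⊗[F] A'}(M ⊗[F] M')`, sending `f` to
`m ⊗ m' ↦ m ⊗ f(m')`, is an isomorphism of `F`-algebras. -/
theorem stmt5 [IsSimpleModule A M]
    (habs : ∀ φ : M →ₗ[A] M, ∃ c : F, ∀ m : M, φ m = c • m) :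
    ∀ Φ : Module.End A' M' →ₐ[F] Module.End (A ⊗[F] A') (M ⊗[F] M'),
      (∀ (f : Module.End A' M') (m : M) (m' : M'),
        Φ f (m ⊗ₜ[F] m') = m ⊗ₜ[F] f m') →
      Function.Bijective Φ := by
  intro Φ hΦ
  have := IsSimpleModule.nontrivial A M
  obtain ⟨m₀, hm₀⟩ := exists_ne (0 : M)
  obtain ⟨l₀, hl₀⟩ := Module.Projective.exists_dual_eq_one F hm₀
  refine ⟨fun f g hfg => LinearMap.ext fun m' => ?_, fun g => ?_⟩
  · have h := congrArg (fun z => TensorProduct.lid F M' (l₀.rTensor M' z))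
      ((hΦ f m₀ m').symm.trans ((LinearMap.congr_fun hfg _).trans (hΦ g m₀ m')))
    simpa [hl₀] using h
  · refine ⟨endOfContractLeft F A A' M M' g m₀ l₀, LinearMap.ext fun z => ?_⟩
    induction z with
    | zero => simp
    | tmul m m' => rw [hΦ, apply_tmul_eq_tmul_endOfContractLeft F A A' M M' habs g hl₀]
    | add x y hx hy => rw [map_add, map_add, hx, hy]
end

section
/- Let F be a field, let A and A' be F-algebras, let M be an absolutely simple left A-module and M' any left A'-module. Then for every A ⊗_F A'-submodule N of M ⊗_F M' there exists an A'-submodule N' ⊆ M' such that N equals the canonical image of M ⊗_F N' inside M ⊗_F M'. In particular, if M' is a simple A'-module, then M ⊗_F M' is a simple A ⊗_F A'-module. -/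
open TensorProduct

variable (F : Type) [Field F]

variable (A A' M M' : Type)
  [Ring A] [Algebra F A] [Ring A'] [Algebra F A']
  [AddCommGroup M] [Module F M] [Module A M] [IsScalarTower F A M]
  [AddCommGroup M'] [Module F M'] [Module A' M'] [IsScalarTower F A' M']

variable {A A' M M' F}

/-- A consequence of Jacobson density: on any given tensor, an `F`-linear endomorphism of an
absolutely simple module acts as some element of `A`. -/
theorem exists_tmul_one_smul_eq_rTensor [IsSimpleModule A M]
    (habs : ∀ φ : M →ₗ[A] M, ∃ c : F, ∀ m : M, φ m = c • m)
    (f : M →ₗ[F] M) (x : M ⊗[F] M') :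
    ∃ a : A, (a ⊗ₜ[F] (1 : A')) • x = f.rTensor M' x := by
  classical
  obtain ⟨S, rfl⟩ := TensorProduct.exists_finset x
  let g : Module.End (Module.End A M) M :=
    { toFun := f
      map_add' := f.map_add
      map_smul' := fun φ m => by
        obtain ⟨c, hc⟩ := habs φ
        simp [hc] }
  obtain ⟨a, ha⟩ := jacobson_density (R := A) g (S.image Prod.fst)
  refine ⟨a, ?_⟩
  rw [Finset.smul_sum, map_sum]
  refine Finset.sum_congr rfl fun p hp => ?_
  rw [tensorTensorModule_smul_tmul, one_smul, LinearMap.rTensor_tmul,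
    ← ha _ (Finset.mem_image_of_mem _ hp)]
  rfl

/-- The submodule of all `n : M'` such that `m ⊗ₜ n ∈ N` for every `m : M`. -/
def rightFactor (N : Submodule (A ⊗[F] A') (M ⊗[F] M')) : Submodule A' M' where
  carrier := {n | ∀ m : M, m ⊗ₜ[F] n ∈ N}
  add_mem' h₁ h₂ m := by
    rw [TensorProduct.tmul_add]
    exact N.add_mem (h₁ m) (h₂ m)
  zero_mem' m := by
    rw [TensorProduct.tmul_zero]
    exact N.zero_mem
  smul_mem' a' n h m := by
    have := N.smul_mem ((1 : A) ⊗ₜ[F] a') (h m)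
    rwa [tensorTensorModule_smul_tmul, one_smul] at this

theorem mem_iff_mem_span_rightFactor [IsSimpleModule A M]
    (habs : ∀ φ : M →ₗ[A] M, ∃ c : F, ∀ m : M, φ m = c • m)
    (N : Submodule (A ⊗[F] A') (M ⊗[F] M')) (x : M ⊗[F] M') :
    x ∈ N ↔ x ∈ Submodule.span F
      {x : M ⊗[F] M' | ∃ (m : M) (n : M'), n ∈ rightFactor N ∧ x = m ⊗ₜ[F] n} := by
  constructor
  · intro hx
    let b := Module.Basis.ofVectorSpace F M
    obtain ⟨c, rfl⟩ := TensorProduct.eq_repr_basis_left b x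
    refine Submodule.sum_mem _ fun i _ => Submodule.subset_span ⟨_, _, fun m => ?_, rfl⟩
    obtain ⟨a, ha⟩ := exists_tmul_one_smul_eq_rTensor (A' := A') habs
      ((b.coord i).smulRight m) (c.sum fun i n => b i ⊗ₜ[F] n)
    have key := ha ▸ N.smul_mem (a ⊗ₜ[F] (1 : A')) hx
    classical
    have h : ((b.coord i).smulRight m).rTensor M' (c.sum fun i n => b i ⊗ₜ[F] n)
        = m ⊗ₜ[F] c i := by
      simp [Finsupp.sum, Finsupp.single_apply, ite_smul, TensorProduct.ite_tmul]
      aesop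
    rwa [h] at key
  · intro hx
    induction hx using Submodule.span_induction with
    | mem x h =>
      obtain ⟨m, n, hn, rfl⟩ := h
      exact hn m
    | zero => exact N.zero_mem
    | add _ _ _ _ h₁ h₂ => exact N.add_mem h₁ h₂
    | smul c _ _ h => exact N.smul_of_tower_mem c h

variable (A A' M M' F)

/-- If `M` is an absolutely simple left `A`-module and `M'` is any left `A'`-module, then every
`A ⊗[F] A'`-submodule `N` of `M ⊗[F] M'` is of the form `M ⊗[F] N'` (i.e. the canonical image
of `M ⊗[F] N'`, the span of the pure tensors `m ⊗ n` with `n ∈ N'`) for some `A'`-submodule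
`N' ⊆ M'`. In particular, if `M'` is a simple `A'`-module then `M ⊗[F] M'` is a simple
`A ⊗[F] A'`-module. -/
theorem stmt6 [IsSimpleModule A M]
    (habs : ∀ φ : M →ₗ[A] M, ∃ c : F, ∀ m : M, φ m = c • m) :
    (∀ N : Submodule (A ⊗[F] A') (M ⊗[F] M'), ∃ N' : Submodule A' M',
      (N : Set (M ⊗[F] M')) =
        (Submodule.span F {x : M ⊗[F] M' | ∃ (m : M) (n : M'), n ∈ N' ∧ x = m ⊗ₜ[F] n} :
          Set (M ⊗[F] M'))) ∧
    (IsSimpleModule A' M' → IsSimpleModule (A ⊗[F] A') (M ⊗[F] M')) := by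
  refine ⟨fun N => ⟨rightFactor N, Set.ext (mem_iff_mem_span_rightFactor habs N)⟩, fun _ => ?_⟩
  have := IsSimpleModule.nontrivial A M
  have := IsSimpleModule.nontrivial A' M'
  have : Nontrivial (M ⊗[F] M') := inferInstance
  rw [isSimpleModule_iff]
  refine { (Submodule.nontrivial_iff (A ⊗[F] A')).2 this with
    eq_bot_or_eq_top := fun N => ?_ }
  rcases eq_bot_or_eq_top (rightFactor N) with h | h
  · left
    refine (Submodule.eq_bot_iff _).2 fun x hx => ?_
    rw [mem_iff_mem_span_rightFactor habs, h] at hx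
    simpa [Submodule.span_eq_bot.2] using hx
  · right
    refine Submodule.eq_top_iff'.2 fun x => ?_
    induction x using TensorProduct.induction_on with
    | zero => exact N.zero_mem
    | tmul m n => exact (h ▸ Submodule.mem_top : n ∈ rightFactor N) m
    | add _ _ h₁ h₂ => exact N.add_mem h₁ h₂
end

section
/- Let F be a field, let B ⊆ A be F-algebras (B a subalgebra of A containing 1), let W be a simple left A-module, let M be a B-submodule of W (with the restricted action) which is absolutely simple over F as a B-module, and let φ ∈ End_A(W) satisfy φ(M) ⊆ M. Then φ = λ·Id_W for some λ ∈ F. In particular, if an A-module W restricts on B exactly to an absolutely F-simple B-module, then W is itself absolutely simple over F. -/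
/-- Let `B ⊆ A` be `F`-algebras (given by an injective algebra map `ι : B →ₐ[F] A`), let `W` be
a simple left `A`-module, let `M` be a `B`-submodule of `W` (the `B`-action on `W` being the one
induced by `ι`) which is absolutely simple over `F` as a `B`-module, and let `φ` be an
`A`-endomorphism of `W` with `φ(M) ⊆ M`.  Then `φ = c • Id_W` for some `c ∈ F`. -/
theorem stmt7 (F A B W : Type) [Field F] [Ring A] [Algebra F A] [Ring B] [Algebra F B]
    (ι : B →ₐ[F] A) (hι : Function.Injective ι)
    [AddCommGroup W] [Module F W] [Module A W] [IsScalarTower F A W]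
    [Module B W] [IsScalarTower F B W]
    (hsmul : ∀ (b : B) (w : W), b • w = ι b • w)
    [IsSimpleModule A W]
    (M : Submodule B W)
    [IsSimpleModule B ↥M]
    (habs : ∀ ψ : ↥M →ₗ[B] ↥M, ∃ c : F, ∀ x : ↥M, ψ x = c • x)
    (φ : W →ₗ[A] W) (hφM : ∀ m ∈ M, φ m ∈ M) :
    ∃ c : F, ∀ w : W, φ w = c • w := by
  let ψ : ↥M →ₗ[B] ↥M :=
    { toFun := fun x => ⟨φ x, hφM x x.2⟩
      map_add' := fun x y => Subtype.ext (by simp)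
      map_smul' := fun b x => Subtype.ext (by simp [hsmul]) }
  obtain ⟨c, hc⟩ := habs ψ
  have : Nontrivial ↥M := IsSimpleModule.nontrivial B ↥M
  obtain ⟨m, hm⟩ := exists_ne (0 : ↥M)
  have hφm : φ (m : W) = c • (m : W) := congrArg Subtype.val (hc m)
  have hmW : (m : W) ≠ 0 := fun h => hm (Subtype.ext h)
  refine ⟨c, fun w => ?_⟩
  obtain ⟨a, rfl⟩ := IsSimpleModule.toSpanSingleton_surjective A hmW w
  rw [LinearMap.toSpanSingleton_apply, map_smul, hφm, ← algebraMap_smul A c (m : W),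
    ← algebraMap_smul A c (a • (m : W)), smul_smul, smul_smul, Algebra.commutes]
end

section
/- Let W = ⊕_{g∈G} W_g be a graded-simple graded left module over a G-graded F-algebra A = ⊕_{g∈G} A_g. Then for every g ∈ G with W_g ≠ 0 one has W = A · W_g, and the homogeneous component W_g is a simple module over the base algebra A_e. -/
/-- The `k`-component of `a • w`, for `w` homogeneous of degree `g`, is `a_{k - g} • w`. -/
theorem coe_decompose_smul_of_mem {F G A W : Type*} [Field F] [AddGroup G] [DecidableEq G]
    [Ring A] [Algebra F A] (𝒜 : G → Submodule F A) [GradedAlgebra 𝒜]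
    [AddCommGroup W] [Module F W] [Module A W]
    (𝒲 : G → Submodule F W) [DirectSum.Decomposition 𝒲]
    (hgrmod : ∀ (g h : G), ∀ a ∈ 𝒜 g, ∀ w ∈ 𝒲 h, a • w ∈ 𝒲 (g + h))
    {g : G} {w : W} (hw : w ∈ 𝒲 g) (k : G) (a : A) :
    (DirectSum.decompose 𝒲 (a • w) k : W) = (DirectSum.decompose 𝒜 a (k - g) : A) • w := by
  induction a using DirectSum.Decomposition.inductionOn 𝒜 with
  | zero => simp
  | @homogeneous i m =>
    by_cases h : i = k - g
    · subst h
      have hk := hgrmod _ _ _ m.2 _ hw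
      rw [sub_add_cancel] at hk
      rw [DirectSum.decompose_of_mem_same _ hk, DirectSum.decompose_of_mem_same _ m.2]
    · rw [DirectSum.decompose_of_mem_ne _ (hgrmod _ _ _ m.2 _ hw)
          (fun h' => h (eq_sub_of_add_eq h')),
        DirectSum.decompose_of_mem_ne _ m.2 h, zero_smul]
  | add a b ha hb => simp [add_smul, DirectSum.decompose_add, ha, hb]

/-- The `A`-span of a set of homogeneous elements of the same degree is a graded submodule. -/
theorem coe_decompose_mem_span {F G A W : Type*} [Field F] [AddGroup G] [DecidableEq G]
    [Ring A] [Algebra F A] (𝒜 : G → Submodule F A) [GradedAlgebra 𝒜]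
    [AddCommGroup W] [Module F W] [Module A W]
    (𝒲 : G → Submodule F W) [DirectSum.Decomposition 𝒲]
    (hgrmod : ∀ (g h : G), ∀ a ∈ 𝒜 g, ∀ w ∈ 𝒲 h, a • w ∈ 𝒲 (g + h))
    {g : G} {S : Set W} (hS : S ⊆ 𝒲 g) {w : W} (hw : w ∈ Submodule.span A S) (k : G) :
    (DirectSum.decompose 𝒲 w k : W) ∈ Submodule.span A S := by
  induction hw using Submodule.closure_induction with
  | zero => simp
  | add x y _ _ hx hy => simpa [DirectSum.decompose_add] using add_mem hx hy
  | smul_mem a x hx =>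
    rw [coe_decompose_smul_of_mem 𝒜 𝒲 hgrmod (hS hx)]
    exact Submodule.smul_mem _ _ (Submodule.subset_span hx)

/-- The degree `g` part of the `A`-span of an `A_0`-stable subspace `P` of `W_g` lies in `P`. -/
theorem coe_decompose_mem_of_mem_span {F G A W : Type*} [Field F] [AddGroup G] [DecidableEq G]
    [Ring A] [Algebra F A] (𝒜 : G → Submodule F A) [GradedAlgebra 𝒜]
    [AddCommGroup W] [Module F W] [Module A W]
    (𝒲 : G → Submodule F W) [DirectSum.Decomposition 𝒲]
    (hgrmod : ∀ (g h : G), ∀ a ∈ 𝒜 g, ∀ w ∈ 𝒲 h, a • w ∈ 𝒲 (g + h))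
    {g : G} {P : Submodule F W} (hP : P ≤ 𝒲 g) (hPA : ∀ a ∈ 𝒜 0, ∀ w ∈ P, a • w ∈ P)
    {w : W} (hw : w ∈ Submodule.span A (P : Set W)) :
    (DirectSum.decompose 𝒲 w g : W) ∈ P := by
  induction hw using Submodule.closure_induction with
  | zero => simp
  | add x y _ _ hx hy => simpa [DirectSum.decompose_add] using add_mem hx hy
  | smul_mem a x hx =>
    rw [coe_decompose_smul_of_mem 𝒜 𝒲 hgrmod (hP hx), sub_self]
    exact hPA _ (SetLike.coe_mem _) _ hx


/-- Let `W = ⊕ W_g` be a graded-simple graded left module over a `G`-graded `F`-algebra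
`A = ⊕ A_g`.  Then for every `g` with `W_g ≠ 0` one has `W = A · W_g`, and `W_g` is a simple
module over the base algebra `A_0` (its only `A_0`-stable `F`-subspaces are `0` and `W_g`). -/
theorem stmt12 (F : Type) [Field F] (G : Type) [AddGroup G] [DecidableEq G]
    (A : Type) [Ring A] [Algebra F A]
    (𝒜 : G → Submodule F A) [GradedAlgebra 𝒜]
    (W : Type) [AddCommGroup W] [Module F W] [Module A W] [IsScalarTower F A W]
    (𝒲 : G → Submodule F W) [DirectSum.Decomposition 𝒲]
    (hgrmod : ∀ (g h : G), ∀ a ∈ 𝒜 g, ∀ w ∈ 𝒲 h, a • w ∈ 𝒲 (g + h))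
    (hW : Nontrivial W)
    (hsimple : ∀ N : Submodule A W,
      (∀ w ∈ N, ∀ g : G, ((DirectSum.decompose 𝒲 w g : ↥(𝒲 g)) : W) ∈ N) →
      N = ⊥ ∨ N = ⊤) :
    ∀ g : G, 𝒲 g ≠ ⊥ →
      Submodule.span A ((𝒲 g : Submodule F W) : Set W) = ⊤ ∧
      ∀ P : Submodule F W, P ≤ 𝒲 g → (∀ a ∈ 𝒜 0, ∀ w ∈ P, a • w ∈ P) →
        P = ⊥ ∨ P = 𝒲 g := by
  have span_eq_top : ∀ (g : G) (P : Submodule F W), P ≤ 𝒲 g → P ≠ ⊥ →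
      Submodule.span A (P : Set W) = ⊤ := by
    intro g P hP hne
    refine (hsimple _ fun w hw k => coe_decompose_mem_span 𝒜 𝒲 hgrmod hP hw k).resolve_left ?_
    intro hbot
    exact hne ((Submodule.eq_bot_iff P).2 (Submodule.span_eq_bot.1 hbot))
  intro g hg
  refine ⟨span_eq_top g _ le_rfl hg, fun P hP hPA => or_iff_not_imp_left.2 fun hne => ?_⟩
  refine le_antisymm hP fun w hw => ?_
  have hmem : w ∈ Submodule.span A (P : Set W) := span_eq_top g P hP hne ▸ Submodule.mem_top
  simpa [DirectSum.decompose_of_mem_same _ hw] using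
    coe_decompose_mem_of_mem_span 𝒜 𝒲 hgrmod hP hPA hmem
end

section
/- Let A = ⊕_{g∈G} A_g be a G-graded F-algebra satisfying the descending chain condition on graded left ideals (every strictly descending chain of graded left ideals of A is finite). Then the base algebra A_e is a left Artinian ring. -/
/-- For a submodule `L` of the base component stable under multiplication by it, every homogeneous
component of an element of the left ideal generated by `L` lies in that ideal, and the component
of degree zero lies in `L`. -/
theorem decompose_mem_span_of_le_zero {F G A : Type*} [Field F] [AddGroup G] [DecidableEq G]
    [Ring A] [Algebra F A] (𝒜 : G → Submodule F A) [GradedAlgebra 𝒜] {L : Submodule F A}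
    (hL : L ≤ 𝒜 0) (hmul : ∀ a ∈ 𝒜 0, ∀ x ∈ L, a * x ∈ L) {x : A}
    (hx : x ∈ Submodule.span A (L : Set A)) :
    (∀ g : G, (DirectSum.decompose 𝒜 x g : A) ∈ Submodule.span A (L : Set A)) ∧
      (DirectSum.decompose 𝒜 x 0 : A) ∈ L := by
  rw [Submodule.mem_span_set'] at hx
  obtain ⟨n, a, y, rfl⟩ := hx
  have key (g : G) : (DirectSum.decompose 𝒜 (∑ i, a i • (y i : A)) g : A) =
      ∑ i, (DirectSum.decompose 𝒜 (a i) g : A) * y i := by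
    rw [DirectSum.decompose_sum, DirectSum.sum_apply, AddSubmonoidClass.coe_finsetSum]
    exact Finset.sum_congr rfl fun i _ =>
      DirectSum.coe_decompose_mul_of_right_mem_zero 𝒜 (hL (y i).2)
  refine ⟨fun g => ?_, ?_⟩
  · rw [key]
    exact Submodule.sum_mem _ fun i _ =>
      Submodule.smul_mem _ _ (Submodule.subset_span (y i).2)
  · rw [key]
    exact Submodule.sum_mem _ fun i _ => hmul _ (SetLike.coe_mem _) _ (y i).2

/-- Let `A = ⊕ A_g` be a `G`-graded `F`-algebra satisfying the descending chain condition on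
graded left ideals (every descending chain of graded left ideals stabilizes).  Then the base
algebra `A_0` is left Artinian: every descending chain of left ideals of `A_0` (realized as
`F`-subspaces of `A` contained in `A_0` and stable under left multiplication by `A_0`)
stabilizes. -/
theorem stmt13 (F : Type) [Field F] (G : Type) [AddGroup G] [DecidableEq G]
    (A : Type) [Ring A] [Algebra F A]
    (𝒜 : G → Submodule F A) [GradedAlgebra 𝒜]
    (hdcc : ∀ f : ℕ → Submodule A A,
      (∀ n : ℕ, ∀ x ∈ f n, ∀ g : G, ((DirectSum.decompose 𝒜 x g : ↥(𝒜 g)) : A) ∈ f n) →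
      (∀ n : ℕ, f (n + 1) ≤ f n) →
      ∃ n : ℕ, ∀ m : ℕ, n ≤ m → f m = f n) :
    ∀ f : ℕ → Submodule F A,
      (∀ n : ℕ, f n ≤ 𝒜 0) →
      (∀ n : ℕ, ∀ a ∈ 𝒜 0, ∀ x ∈ f n, a * x ∈ f n) →
      (∀ n : ℕ, f (n + 1) ≤ f n) →
      ∃ n : ℕ, ∀ m : ℕ, n ≤ m → f m = f n := by
  intro f h0 hmul hanti
  obtain ⟨n, hn⟩ := hdcc (fun n => Submodule.span A (f n : Set A))
    (fun n x hx => (decompose_mem_span_of_le_zero 𝒜 (h0 n) (hmul n) hx).1)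
    (fun n => Submodule.span_mono (hanti n))
  refine ⟨n, fun m hm => le_antisymm (antitone_nat_of_succ_le hanti hm) fun x hx => ?_⟩
  have hxm : x ∈ Submodule.span A (f m : Set A) :=
    (hn m hm).ge (Submodule.subset_span hx)
  have h := (decompose_mem_span_of_le_zero 𝒜 (h0 m) (hmul m) hxm).2
  rwa [DirectSum.decompose_of_mem_same 𝒜 (h0 n hx)] at h
end

section
/- Let W = ⊕_{g∈G} W_g be a graded-simple graded left module over a G-graded F-algebra A = ⊕_{g∈G} A_g, and let g ∈ G be in the support of W (W_g ≠ 0). Then the restriction map φ ↦ φ|_{W_g} is an F-algebra isomorphism from the algebra End^e_A(W) of A-module endomorphisms φ of W satisfying φ(W_h) ⊆ W_h for all h ∈ G, onto End_{A_e}(W_g), the A_e-module endomorphism algebra of the component W_g. -/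
section GradedModule

open DirectSum

variable {F G A W : Type*} [Field F] [AddGroup G] [DecidableEq G] [Ring A] [Algebra F A]
  {𝒜 : G → Submodule F A} [AddCommGroup W] [Module F W] [Module A W]
  {𝒲 : G → Submodule F W} [Decomposition 𝒲]

/-- The component of degree `g` of `a • x`, for `a` homogeneous of degree `k`. -/
theorem decompose_smul_of_left_mem
    (hgrmod : ∀ g h : G, ∀ a ∈ 𝒜 g, ∀ w ∈ 𝒲 h, a • w ∈ 𝒲 (g + h))
    {a : A} {k : G} (ha : a ∈ 𝒜 k) (x : W) (g : G) :
    (decompose 𝒲 (a • x) g : W) = a • (decompose 𝒲 x (-k + g) : W) := by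
  induction x using Decomposition.inductionOn 𝒲 with
  | zero => simp
  | @homogeneous h x =>
    have hax := hgrmod k h a ha x x.2
    by_cases hk : k + h = g
    · subst hk
      rw [decompose_of_mem_same _ hax, neg_add_cancel_left, decompose_of_mem_same _ x.2]
    · rw [decompose_of_mem_ne _ hax hk,
        decompose_of_mem_ne _ x.2 (fun hk' => hk (by rw [hk', add_neg_cancel_left])), smul_zero]
  | add x y ihx ihy => simp [smul_add, decompose_add, ihx, ihy]

variable [GradedAlgebra 𝒜]

/-- The component of degree `g` of `a • x`, for `x` homogeneous of degree `h`. -/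
theorem decompose_smul_of_right_mem
    (hgrmod : ∀ g h : G, ∀ a ∈ 𝒜 g, ∀ w ∈ 𝒲 h, a • w ∈ 𝒲 (g + h))
    (a : A) {x : W} {h : G} (hx : x ∈ 𝒲 h) (g : G) :
    (decompose 𝒲 (a • x) g : W) = (decompose 𝒜 a (g - h) : A) • x := by
  induction a using Decomposition.inductionOn 𝒜 with
  | zero => simp
  | @homogeneous k a =>
    have hax := hgrmod k h a a.2 x hx
    by_cases hk : k + h = g
    · subst hk
      rw [decompose_of_mem_same _ hax, add_sub_cancel_right, decompose_of_mem_same _ a.2]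
    · rw [decompose_of_mem_ne _ hax hk,
        decompose_of_mem_ne _ a.2 (fun hk' => hk (by rw [hk', sub_add_cancel])), zero_smul]
  | add a b iha ihb => simp [add_smul, decompose_add, iha, ihb]

theorem decompose_smul_decompose
    (hgrmod : ∀ g h : G, ∀ a ∈ 𝒜 g, ∀ w ∈ 𝒲 h, a • w ∈ 𝒲 (g + h))
    (a : A) (x : W) (g h : G) :
    decompose 𝒲 (a • (decompose 𝒲 x h : W)) g =
      decompose 𝒲 ((decompose 𝒜 a (g - h) : A) • x) g := by
  ext
  rw [decompose_smul_of_right_mem hgrmod a (decompose 𝒲 x h).2,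
    decompose_smul_of_left_mem hgrmod (decompose 𝒜 a (g - h)).2]
  rw [neg_sub, sub_add_cancel]

variable (A 𝒲) in
/-- The pairs `(x, y)` such that `u` maps the component of degree `g` of `a • x` to that of
`a • y`, for all `a`. -/
def componentRel {g : G} (u : 𝒲 g →ₗ[F] 𝒲 g) : Submodule A (W × W) where
  carrier := {p | ∀ a : A, u (decompose 𝒲 (a • p.1) g) = decompose 𝒲 (a • p.2) g}
  zero_mem' a := by simp
  add_mem' hp hq a := by simp [smul_add, decompose_add, hp a, hq a]
  smul_mem' b p hp a := by simpa [mul_smul] using hp (a * b)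

theorem decompose_mem_componentRel
    (hgrmod : ∀ g h : G, ∀ a ∈ 𝒜 g, ∀ w ∈ 𝒲 h, a • w ∈ 𝒲 (g + h))
    {g : G} {u : 𝒲 g →ₗ[F] 𝒲 g} {x y : W} (hxy : (x, y) ∈ componentRel A 𝒲 u) (h : G) :
    ((decompose 𝒲 x h : W), (decompose 𝒲 y h : W)) ∈ componentRel A 𝒲 u := fun a => by
  simpa only [decompose_smul_decompose hgrmod] using hxy (decompose 𝒜 a (g - h))

theorem mk_mem_componentRel
    (hgrmod : ∀ g h : G, ∀ a ∈ 𝒜 g, ∀ w ∈ 𝒲 h, a • w ∈ 𝒲 (g + h))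
    {g : G} {u : 𝒲 g →ₗ[F] 𝒲 g}
    (hu : ∀ a ∈ 𝒜 0, ∀ (w : 𝒲 g) (hw : a • (w : W) ∈ 𝒲 g),
      (u ⟨a • (w : W), hw⟩ : W) = a • (u w : W)) (w : 𝒲 g) :
    ((w : W), (u w : W)) ∈ componentRel A 𝒲 u := fun a => by
  have hcomp (v : 𝒲 g) : (decompose 𝒲 (a • (v : W)) g : W) = (decompose 𝒜 a 0 : A) • (v : W) := by
    rw [decompose_smul_of_right_mem hgrmod a v.2, sub_self]
  ext
  rw [hcomp, ← hu _ (decompose 𝒜 a 0).2 w (hcomp w ▸ (decompose 𝒲 (a • (w : W)) g).2)]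
  congr 2
  exact Subtype.ext (hcomp w)

end GradedModule

/-- Let `W = ⊕ W_g` be a graded-simple graded left module over a `G`-graded `F`-algebra
`A = ⊕ A_g`, and let `g` be in the support of `W`.  Then restriction to `W_g` is an
isomorphism from the algebra `End^e_A(W)` of degree-preserving `A`-endomorphisms of `W` onto
the algebra of `A_0`-linear endomorphisms of `W_g`: it is injective, and every `A_0`-linear
endomorphism of `W_g` is the restriction of a degree-preserving `A`-endomorphism of `W`. -/
theorem stmt15 (F : Type) [Field F] (G : Type) [AddGroup G] [DecidableEq G]
    (A : Type) [Ring A] [Algebra F A]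
    (𝒜 : G → Submodule F A) [GradedAlgebra 𝒜]
    (W : Type) [AddCommGroup W] [Module F W] [Module A W] [IsScalarTower F A W]
    (𝒲 : G → Submodule F W) [DirectSum.Decomposition 𝒲]
    (hgrmod : ∀ (g h : G), ∀ a ∈ 𝒜 g, ∀ w ∈ 𝒲 h, a • w ∈ 𝒲 (g + h))
    (hW : Nontrivial W)
    (hsimple : ∀ N : Submodule A W,
      (∀ w ∈ N, ∀ g : G, ((DirectSum.decompose 𝒲 w g : ↥(𝒲 g)) : W) ∈ N) →
      N = ⊥ ∨ N = ⊤)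
    (g : G) (hg : 𝒲 g ≠ ⊥) :
    (∀ φ ψ : W →ₗ[A] W,
      (∀ h : G, ∀ w ∈ 𝒲 h, φ w ∈ 𝒲 h) → (∀ h : G, ∀ w ∈ 𝒲 h, ψ w ∈ 𝒲 h) →
      (∀ w ∈ 𝒲 g, φ w = ψ w) → φ = ψ) ∧
    (∀ u : ↥(𝒲 g) →ₗ[F] ↥(𝒲 g),
      (∀ a ∈ 𝒜 0, ∀ (w : ↥(𝒲 g)) (hw : a • (w : W) ∈ 𝒲 g),
        (u ⟨a • (w : W), hw⟩ : W) = a • (u w : W)) →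
      ∃ φ : W →ₗ[A] W, (∀ h : G, ∀ w ∈ 𝒲 h, φ w ∈ 𝒲 h) ∧
        ∀ w : ↥(𝒲 g), φ (w : W) = (u w : W)) := by
  have top_of_mem (N : Submodule A W)
      (hN : ∀ w ∈ N, ∀ h : G, ((DirectSum.decompose 𝒲 w h : ↥(𝒲 h)) : W) ∈ N)
      (hgN : ∀ w ∈ 𝒲 g, w ∈ N) : N = ⊤ := by
    refine (hsimple N hN).resolve_left ?_
    rintro rfl
    exact hg ((Submodule.eq_bot_iff _).2 hgN)
  refine ⟨fun φ ψ hφ hψ hφψ => ?_, fun u hu => ?_⟩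
  · have decompose_map (χ : W →ₗ[A] W) (hχ : ∀ h : G, ∀ w ∈ 𝒲 h, χ w ∈ 𝒲 h) (w : W) (h : G) :
        χ (DirectSum.decompose 𝒲 w h : W) = (DirectSum.decompose 𝒲 (χ w) h : W) := by
      induction w using DirectSum.Decomposition.inductionOn 𝒲 with
      | zero => simp
      | @homogeneous k w =>
        by_cases hk : k = h
        · subst hk
          rw [DirectSum.decompose_of_mem_same _ w.2, DirectSum.decompose_of_mem_same _ (hχ k w w.2)]
        · rw [DirectSum.decompose_of_mem_ne _ w.2 hk,
            DirectSum.decompose_of_mem_ne _ (hχ k w w.2) hk, map_zero]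
      | add x y ihx ihy => simp [DirectSum.decompose_add, ihx, ihy]
    refine LinearMap.eqLocus_eq_top.1 (top_of_mem _ (fun w hw h => ?_) hφψ)
    rw [LinearMap.mem_eqLocus] at hw ⊢
    rw [decompose_map φ hφ, decompose_map ψ hψ, hw]
  · have eq_zero (y : W) (hy : ((0 : W), y) ∈ componentRel A 𝒲 u) : y = 0 := by
      let K := (componentRel A 𝒲 u).comap (LinearMap.inr A W W)
      have hK : K = ⊥ := by
        refine (hsimple K fun w hw h => ?_).resolve_right fun hK => hg ?_
        · rw [Submodule.mem_comap, LinearMap.inr_apply] at hw ⊢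
          simpa using decompose_mem_componentRel hgrmod hw h
        · refine (Submodule.eq_bot_iff _).2 fun w hw => ?_
          have hwK : w ∈ K := hK ▸ Submodule.mem_top
          have hw0 : u _ = _ := hwK 1
          rw [← DirectSum.decompose_of_mem_same 𝒲 hw]
          simpa using congrArg Subtype.val hw0.symm
      exact (Submodule.mem_bot A).1 (hK ▸ hy)
    have unique {x y z : W} (hy : (x, y) ∈ componentRel A 𝒲 u)
        (hz : (x, z) ∈ componentRel A 𝒲 u) : y = z :=
      sub_eq_zero.1 (eq_zero _ (by simpa using sub_mem hy hz))
    have total (x : W) : ∃ y, (x, y) ∈ componentRel A 𝒲 u := by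
      have htop : (componentRel A 𝒲 u).map (LinearMap.fst A W W) = ⊤ := by
        refine top_of_mem _ ?_ fun w hw => ⟨_, mk_mem_componentRel hgrmod hu ⟨w, hw⟩, rfl⟩
        rintro _ ⟨⟨x, y⟩, hxy, rfl⟩ h
        exact ⟨_, decompose_mem_componentRel hgrmod hxy h, rfl⟩
      obtain ⟨⟨_, y⟩, hxy, rfl⟩ := htop ▸ Submodule.mem_top (x := x)
      exact ⟨y, hxy⟩
    choose f hf using total
    refine ⟨{ toFun := f
              map_add' := fun x y => unique (hf _) (add_mem (hf x) (hf y))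
              map_smul' := fun a x => unique (hf _) (Submodule.smul_mem _ a (hf x)) },
      fun h w hw => ?_, fun w => unique (hf _) (mk_mem_componentRel hgrmod hu w)⟩
    have hfw := decompose_mem_componentRel hgrmod (hf w) h
    rw [DirectSum.decompose_of_mem_same _ hw] at hfw
    change f w ∈ 𝒲 h
    rw [← unique hfw (hf w)]
    exact (DirectSum.decompose 𝒲 (f w) h).2
end

section
/- Let A = ⊕_{g∈G} A_g be a graded-simple G-graded F-algebra (A has no two-sided graded ideals other than 0 and A), and let I and I' be minimal graded left ideals of A (nonzero graded left ideals containing no graded left ideal other than 0 and themselves). Then there exists g ∈ G and an A-module isomorphism φ : I → I' such that φ(I ∩ A_h) = I' ∩ A_{hg} for every h ∈ G; i.e. I is graded-isomorphic to the g-suspension of I'. -/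
open DirectSum in
/-- If every homogeneous component of `y` is killed by left multiplication with `x`,
then so is `y`. -/
theorem mul_eq_zero_of_mul_decompose_eq_zero {F G A : Type*} [Field F] [AddGroup G]
    [DecidableEq G] [Ring A] [Algebra F A] (𝒜 : G → Submodule F A) [GradedAlgebra 𝒜] {x y : A}
    (h : ∀ g, x * (decompose 𝒜 y g : A) = 0) : x * y = 0 := by
  classical
  rw [← sum_support_decompose 𝒜 y, Finset.mul_sum]
  exact Finset.sum_eq_zero fun g _ ↦ h g


/-- Let `A = ⊕ A_g` be a graded-simple `G`-graded `F`-algebra and let `I`, `I'` be minimal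
graded left ideals of `A`.  Then there exist `g ∈ G` and an `A`-module isomorphism
`φ : I ≃ I'` with `φ(I ∩ A_h) = I' ∩ A_{h+g}` for every `h`; i.e. `I` is graded-isomorphic to
the `g`-suspension of `I'`. -/
theorem stmt16 (F : Type) [Field F] (G : Type) [AddGroup G] [DecidableEq G]
    (A : Type) [Ring A] [Algebra F A]
    (𝒜 : G → Submodule F A) [GradedAlgebra 𝒜]
    (hgrsimple : ∀ I : Submodule A A,
      (∀ x ∈ I, ∀ g : G, ((DirectSum.decompose 𝒜 x g : ↥(𝒜 g)) : A) ∈ I) →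
      (∀ x ∈ I, ∀ a : A, x * a ∈ I) → I = ⊥ ∨ I = ⊤)
    (I I' : Submodule A A)
    (hIgr : ∀ x ∈ I, ∀ g : G, ((DirectSum.decompose 𝒜 x g : ↥(𝒜 g)) : A) ∈ I)
    (hI'gr : ∀ x ∈ I', ∀ g : G, ((DirectSum.decompose 𝒜 x g : ↥(𝒜 g)) : A) ∈ I')
    (hIne : I ≠ ⊥) (hI'ne : I' ≠ ⊥)
    (hImin : ∀ J : Submodule A A,
      (∀ x ∈ J, ∀ g : G, ((DirectSum.decompose 𝒜 x g : ↥(𝒜 g)) : A) ∈ J) →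
      J ≤ I → J = ⊥ ∨ J = I)
    (hI'min : ∀ J : Submodule A A,
      (∀ x ∈ J, ∀ g : G, ((DirectSum.decompose 𝒜 x g : ↥(𝒜 g)) : A) ∈ J) →
      J ≤ I' → J = ⊥ ∨ J = I') :
    ∃ (g : G) (φ : ↥I ≃ₗ[A] ↥I'),
      ∀ (h : G) (x : ↥I), (x : A) ∈ 𝒜 h ↔ ((φ x : A) ∈ 𝒜 (h + g)) := by
  let J : Submodule A A :=
    { carrier := {x | ∀ y ∈ I', x * y = 0}
      add_mem' := fun ha hb y hy ↦ by rw [add_mul, ha y hy, hb y hy, add_zero]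
      zero_mem' := fun y _ ↦ zero_mul y
      smul_mem' := fun a x hx y hy ↦ by rw [smul_eq_mul, mul_assoc, hx y hy, mul_zero] }
  have hJ : J = ⊥ := by
    refine (hgrsimple J ?_ ?_).resolve_right fun h ↦ hI'ne ?_
    · intro x hx g y hy
      refine mul_eq_zero_of_mul_decompose_eq_zero 𝒜 fun k ↦ ?_
      rw [← DirectSum.coe_decompose_mul_add_of_right_mem 𝒜 (SetLike.coe_mem _),
        hx _ (hI'gr y hy k)]
      simp
    · intro x hx a y hy
      rw [mul_assoc]
      exact hx _ (I'.smul_mem a hy)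
    · have h1 : (1 : A) ∈ J := h ▸ Submodule.mem_top
      exact (Submodule.eq_bot_iff _).2 fun y hy ↦ by simpa using h1 y hy
  obtain ⟨x₀, hx₀, hx₀ne⟩ := I.ne_bot_iff.1 hIne
  obtain ⟨g, y, hyI', hyg, hxy⟩ : ∃ g, ∃ y ∈ I', y ∈ 𝒜 g ∧ x₀ * y ≠ 0 := by
    by_contra! hcon
    have hmem : x₀ ∈ J := fun y hy ↦ mul_eq_zero_of_mul_decompose_eq_zero 𝒜 fun k ↦
      hcon k _ (hI'gr y hy k) (SetLike.coe_mem _)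
    rw [hJ, Submodule.mem_bot] at hmem
    exact hx₀ne hmem
  have hdec (x : A) (h : G) : (DirectSum.decompose 𝒜 (x * y) (h + g) : A) =
      DirectSum.decompose 𝒜 x h * y := DirectSum.coe_decompose_mul_add_of_right_mem 𝒜 hyg
  have hker : I ⊓ LinearMap.ker (LinearMap.toSpanSingleton A A y) = ⊥ := by
    refine (hImin _ ?_ inf_le_left).resolve_right fun h ↦ hxy ?_
    · rintro x ⟨hx, hxk⟩ k
      refine ⟨hIgr x hx k, ?_⟩
      simp only [SetLike.mem_coe, LinearMap.mem_ker, LinearMap.toSpanSingleton_apply,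
        smul_eq_mul] at hxk ⊢
      rw [← hdec, hxk]
      simp
    · simpa using (h.symm.le hx₀).2
  have hrange : I.map (LinearMap.toSpanSingleton A A y) = I' := by
    refine (hI'min _ ?_ ?_).resolve_left fun h ↦ hxy ?_
    · rintro _ ⟨x, hx, rfl⟩ k
      refine ⟨_, hIgr x hx (k - g), ?_⟩
      simp only [LinearMap.toSpanSingleton_apply, smul_eq_mul]
      rw [← hdec, sub_add_cancel]
    · rintro _ ⟨x, hx, rfl⟩
      exact I'.smul_mem x hyI'
    · simpa using h.le (Submodule.mem_map_of_mem hx₀)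
  have hinj (x : A) (hx : x ∈ I) (h : x * y = 0) : x = 0 :=
    (Submodule.mem_bot A).1 (hker.le ⟨hx, by simpa using h⟩)
  let f : I →ₗ[A] I' := (LinearMap.toSpanSingleton A A y).restrict
    fun x _ ↦ I'.smul_mem x hyI'
  have hf (x : I) : (f x : A) = x * y := rfl
  refine ⟨g, LinearEquiv.ofBijective f ⟨?_, ?_⟩, fun h x ↦ ?_⟩
  · refine (injective_iff_map_eq_zero f).2 fun x hx ↦ Subtype.ext (hinj x x.2 ?_)
    rw [← hf, hx, ZeroMemClass.coe_zero]
  · rintro ⟨z, hz⟩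
    obtain ⟨x, hx, rfl⟩ := hrange.symm.le hz
    exact ⟨⟨x, hx⟩, rfl⟩
  · change (x : A) ∈ 𝒜 h ↔ (x : A) * y ∈ 𝒜 (h + g)
    refine ⟨fun hx ↦ SetLike.mul_mem_graded hx hyg, fun hx ↦ ?_⟩
    have hdiff := hinj _ (I.sub_mem x.2 (hIgr x x.2 h)) <| by
      rw [sub_mul, ← hdec, DirectSum.decompose_of_mem_same 𝒜 hx, sub_self]
    rw [sub_eq_zero.1 hdiff]
    exact SetLike.coe_mem _
end
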